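/- arXiv:1502.03945 — 2 statements merged into one kernel-verified Lean document; each statement's English description precedes it below -/
import Mathlib

section
/- Let (x,q) be an equilibrium of a price competition game and let x' be any assignment consistent to q with the property that for every buyer type i and every vendor j' with x'_{ij'} > 0, the vendor j' maximizes v_{ij''} − c_{j''} over all vendors j'' in the demand set of i, i.e., over all j'' with v_{ij''} − q_{j''} = max_{j∈M}(v_{ij} − q_j). Then (x',q) is also an equilibrium. In particular, for every buyer type i with x_{ij} > 0 and x'_{ij'} > 0 for distinct vendors j ≠ j', it holds that q_j = c_j and q_{j'} = c_{j'}. -/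
open Finset

/-- A price competition game with buyer types `N` and vendors `M`
(including the special "abstain" vendor). -/
structure PCGame (N M : Type) [Fintype N] [Fintype M] where
  abstain : M
  μ : N → ℝ
  v : N → M → ℝ
  c : M → ℝ
  μ_pos : ∀ i, 0 < μ i
  v_nonneg : ∀ i j, 0 ≤ v i j
  c_nonneg : ∀ j, 0 ≤ c j
  v_abstain : ∀ i, v i abstain = 0
  c_abstain : c abstain = 0

namespace PCGame

variable {N M : Type} [Fintype N] [Fintype M]

/-- `p` is a valid price vector: every price is at least the production cost and
the abstain vendor has price `0`. -/
def IsPrice (G : PCGame N M) (p : M → ℝ) : Prop :=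
  (∀ j, G.c j ≤ p j) ∧ p G.abstain = 0

/-- `x` is a valid buyers-to-vendors assignment. -/
def IsAssignment (G : PCGame N M) (x : N → M → ℝ) : Prop :=
  (∀ i j, 0 ≤ x i j) ∧ ∀ i, ∑ j, x i j = G.μ i

/-- `x` is consistent to `p`: positive volume goes only to utility-maximizing vendors. -/
def Consistent (G : PCGame N M) (x : N → M → ℝ) (p : M → ℝ) : Prop :=
  ∀ i j, 0 < x i j → ∀ j', G.v i j' - p j' ≤ G.v i j - p j

/-- Utility of vendor `j` under assignment `x` and prices `p`. -/
noncomputable def util (G : PCGame N M) (x : N → M → ℝ) (p : M → ℝ) (j : M) : ℝ :=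
  (p j - G.c j) * ∑ i, x i j

/-- Total utility of the buyers of type `i`. -/
noncomputable def buyerUtil (G : PCGame N M) (x : N → M → ℝ) (p : M → ℝ) (i : N) : ℝ :=
  ∑ j, x i j * (G.v i j - p j)

/-- `(x, p)` is a (pure Nash) equilibrium: `x` is consistent to `p` and no (non-abstain)
vendor can increase its utility by deviating to another price. -/
def IsEquilibrium [DecidableEq M] (G : PCGame N M) (x : N → M → ℝ) (p : M → ℝ) : Prop :=
  G.IsPrice p ∧ G.IsAssignment x ∧ G.Consistent x p ∧
    ∀ j, j ≠ G.abstain → ∀ p' : ℝ, G.c j ≤ p' →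
      ∀ y, G.IsAssignment y → G.Consistent y (Function.update p j p') →
        G.util y (Function.update p j p') j ≤ G.util x p j

/-- Social welfare of assignment `x`. -/
noncomputable def SW (G : PCGame N M) (x : N → M → ℝ) : ℝ :=
  ∑ i, ∑ j, x i j * (G.v i j - G.c j)

/-- Optimal social welfare. -/
noncomputable def SWopt (G : PCGame N M) : ℝ :=
  ∑ i, G.μ i * Finset.univ.sup' ⟨G.abstain, Finset.mem_univ _⟩ (fun j => G.v i j - G.c j)

/-- `θ_j(p)`: the supremum utility of vendor `j` over all of its price deviations
(the abstain vendor cannot deviate from price `0`). -/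
noncomputable def theta [DecidableEq M] (G : PCGame N M) (p : M → ℝ) (j : M) : ℝ :=
  sSup {u : ℝ | ∃ (p' : ℝ) (y : N → M → ℝ), G.c j ≤ p' ∧ (j = G.abstain → p' = 0) ∧
    G.IsAssignment y ∧ G.Consistent y (Function.update p j p') ∧
    u = G.util y (Function.update p j p') j}

/-- The minimum subsidy that makes vendor `j` not want to deviate from `(x, p)`. -/
noncomputable def subsidy [DecidableEq M] (G : PCGame N M) (x : N → M → ℝ) (p : M → ℝ)
    (j : M) : ℝ :=
  G.theta p j - G.util x p j

end PCGame

namespace PCGame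

variable {N M : Type} [Fintype N] [Fintype M]

/-- The volume a buyer type sends to two distinct vendors is at most its total volume. -/
theorem IsAssignment.add_le {G : PCGame N M} {x : N → M → ℝ} (hx : G.IsAssignment x)
    (i : N) {j k : M} (hjk : j ≠ k) : x i j + x i k ≤ G.μ i := by
  classical
  rw [← hx.2 i, ← Finset.sum_pair hjk]
  exact Finset.sum_le_sum_of_subset_of_nonneg (Finset.subset_univ _) fun l _ _ => hx.1 i l

theorem IsAssignment.le {G : PCGame N M} {x : N → M → ℝ} (hx : G.IsAssignment x)
    (i : N) (j : M) : x i j ≤ G.μ i := by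
  rw [← hx.2 i]
  exact Finset.single_le_sum (fun l _ => hx.1 i l) (Finset.mem_univ j)

/-- A buyer type sends nothing to vendors outside its demand set. -/
theorem IsAssignment.eq_zero_of_not_demanded {G : PCGame N M} {x : N → M → ℝ} {p : M → ℝ}
    (hx : G.IsAssignment x) (hc : G.Consistent x p) {i : N} {j : M}
    (hj : ¬ ∀ k, G.v i k - p k ≤ G.v i j - p j) : x i j = 0 :=
  le_antisymm (not_lt.mp fun hpos => hj (hc i j hpos)) (hx.1 i j)

/-- After vendor `j` lowers its price, there is a consistent assignment in which `j` loses no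
buyers and receives all the volume of every buyer type that demanded it before. -/
theorem exists_consistent_of_price_cut [DecidableEq M] {G : PCGame N M} {x : N → M → ℝ}
    {p : M → ℝ} (hx : G.IsAssignment x) (hc : G.Consistent x p) (j : M) {r : ℝ} (hr : r ≤ p j) :
    ∃ y, G.IsAssignment y ∧ G.Consistent y (Function.update p j r) ∧ (∀ i, x i j ≤ y i j) ∧
      ∀ i, (∀ k, G.v i k - p k ≤ G.v i j - p j) → y i j = G.μ i := by
  classical
  let D : N → Prop := fun i => ∀ k, k ≠ j → G.v i k - p k ≤ G.v i j - r
  have hyD (i : N) (hi : D i) : (if D i then Pi.single j (G.μ i) else x i) = Pi.single j (G.μ i) :=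
    if_pos hi
  have hyn (i : N) (hi : ¬ D i) : (if D i then Pi.single j (G.μ i) else x i) = x i := if_neg hi
  refine ⟨fun i => if D i then Pi.single j (G.μ i) else x i, ⟨fun i k => ?_, fun i => ?_⟩,
    fun i k hk l => ?_, fun i => ?_, fun i hi => ?_⟩
  · by_cases hi : D i
    · simp only [hyD i hi]
      rcases eq_or_ne k j with rfl | hkj
      · simpa using (G.μ_pos i).le
      · simp [hkj]
    · simpa only [hyn i hi] using hx.1 i k
  · by_cases hi : D i
    · simp [hyD i hi]
    · simpa only [hyn i hi] using hx.2 i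
  · by_cases hi : D i
    · simp only [hyD i hi] at hk
      rcases eq_or_ne k j with rfl | hkj
      · rcases eq_or_ne l k with rfl | hlk
        · rfl
        · simpa [hlk] using hi l hlk
      · simp [hkj] at hk
    · simp only [hyn i hi] at hk
      have hmax := hc i k hk
      have hkj : k ≠ j := by
        rintro rfl
        exact hi fun l _ => by linarith [hmax l]
      rcases eq_or_ne l j with rfl | hlj
      · obtain ⟨m, -, hm⟩ : ∃ m, m ≠ l ∧ G.v i l - r < G.v i m - p m := by
          by_contra! hle
          exact hi hle
        simpa [hkj] using hm.le.trans (hmax m)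
      · simpa [hkj, hlj] using hmax l
  · by_cases hi : D i
    · simpa [hyD i hi] using hx.le i j
    · simp [hyn i hi]
  · simp [hyD i fun k _ => (hi k).trans (by linarith)]

/-- In an equilibrium, a vendor pricing above cost receives all the volume of every buyer type
that demands it: otherwise a small price cut would be profitable. -/
theorem IsEquilibrium.eq_volume_of_demanded [DecidableEq M] {G : PCGame N M} {x : N → M → ℝ}
    {q : M → ℝ} (h : G.IsEquilibrium x q) {i : N} {j : M} (hj : G.c j < q j)
    (hd : ∀ k, G.v i k - q k ≤ G.v i j - q j) : x i j = G.μ i := by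
  obtain ⟨hp, hx, hc, hdev⟩ := h
  by_contra hne
  have hlt : x i j < G.μ i := lt_of_le_of_ne (hx.le i j) hne
  have hja : j ≠ G.abstain := by
    rintro rfl
    simp [hp.2, G.c_abstain] at hj
  set S := ∑ k, x k j with hS
  set δ := G.μ i - x i j with hδ
  set m := q j - G.c j with hm
  have hS0 : 0 ≤ S := Finset.sum_nonneg fun k _ => hx.1 k j
  have hδ0 : 0 < δ := sub_pos.mpr hlt
  have hm0 : 0 < m := sub_pos.mpr hj
  set ε := m * δ / (2 * (S + δ)) with hε
  have hεS : ε * (S + δ) = m * δ / 2 := by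
    rw [hε]
    field_simp
  have hε0 : 0 < ε := by positivity
  have hεm : ε ≤ m := by
    rw [hε, div_le_iff₀ (by positivity)]
    nlinarith
  obtain ⟨y, hy, hyc, hxy, hyd⟩ := exists_consistent_of_price_cut hx hc j
    (r := q j - ε) (by linarith)
  have hY : S + δ ≤ ∑ k, y k j := by
    have h1 : y i j - x i j ≤ ∑ k, (y k j - x k j) :=
      Finset.single_le_sum (f := fun k => y k j - x k j)
        (fun k _ => sub_nonneg.mpr (hxy k)) (Finset.mem_univ i)
    rw [Finset.sum_sub_distrib, hyd i hd] at h1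
    linarith
  have hu := hdev j hja (q j - ε) (by linarith) y hy hyc
  simp only [util, Function.update_self] at hu
  have h2 : (m - ε) * (S + δ) ≤ (m - ε) * ∑ k, y k j :=
    mul_le_mul_of_nonneg_left hY (by linarith)
  have h3 : (q j - ε - G.c j) * ∑ k, y k j = (m - ε) * ∑ k, y k j := by rw [hm]; ring
  have h4 : 0 < m * δ := mul_pos hm0 hδ0
  rw [h3, ← hS, ← hm] at hu
  linarith [sub_mul m ε (S + δ), mul_add m S δ]

end PCGame

/-- given an equilibrium `(x, q)` and another consistent assignment `x'`
that sends each buyer type to a vendor maximizing `v - c` within its demand set,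
`(x', q)` is also an equilibrium; in particular vendors between which buyers are
reassigned price at cost. -/
theorem stmt9 {N M : Type} [Fintype N] [Fintype M] [DecidableEq M]
    (G : PCGame N M) (x : N → M → ℝ) (q : M → ℝ)
    (h : G.IsEquilibrium x q)
    (x' : N → M → ℝ) (hx' : G.IsAssignment x') (hcons : G.Consistent x' q)
    (hopt : ∀ i j', 0 < x' i j' → ∀ j'',
      (∀ j, G.v i j - q j ≤ G.v i j'' - q j'') →
      G.v i j'' - G.c j'' ≤ G.v i j' - G.c j') :
    G.IsEquilibrium x' q ∧
      ∀ i j j', j ≠ j' → 0 < x i j → 0 < x' i j' → q j = G.c j ∧ q j' = G.c j' := by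
  have ⟨hp, hx, hc, hdev⟩ := h
  have key (i : N) (j : M) (hj : G.c j < q j) : x' i j = x i j := by
    by_cases hd : ∀ k, G.v i k - q k ≤ G.v i j - q j
    · have hxj := h.eq_volume_of_demanded hj hd
      rw [hxj, ← hx'.2 i]
      refine (Finset.sum_eq_single j (fun k _ hkj => ?_) (by simp)).symm
      by_contra hk
      have hpos : 0 < x' i k := lt_of_le_of_ne (hx'.1 i k) (Ne.symm hk)
      have hdk := hcons i k hpos
      have hck : G.c k < q k := by linarith [hopt i k hpos j hd, hd k]
      have hxk := h.eq_volume_of_demanded hck hdk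
      linarith [hx.add_le i hkj, G.μ_pos i]
    · rw [hx.eq_zero_of_not_demanded hc hd, hx'.eq_zero_of_not_demanded hcons hd]
  have hutil (j : M) : G.util x' q j = G.util x q j := by
    rcases (hp.1 j).eq_or_lt with hj | hj
    · simp [PCGame.util, hj]
    · simp only [PCGame.util, key _ j hj]
  refine ⟨⟨hp, hx', hcons, fun j hj r hr y hy hyc => ?_⟩, fun i j k hjk hxj hxk => ⟨?_, ?_⟩⟩
  · rw [hutil]
    exact hdev j hj r hr y hy hyc
  · by_contra hne
    have hj : G.c j < q j := lt_of_le_of_ne (hp.1 j) (Ne.symm hne)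
    have hvol := h.eq_volume_of_demanded hj (hc i j hxj)
    linarith [key i j hj, hx'.add_le i hjk]
  · by_contra hne
    have hk : G.c k < q k := lt_of_le_of_ne (hp.1 k) (Ne.symm hne)
    have hvol := h.eq_volume_of_demanded hk (hcons i k hxk)
    linarith [hx.add_le i hjk]
end

section
/- Given an Exact-3-Cover instance (U, 𝒞), the constructed price competition game admits an equilibrium if and only if the instance admits an exact cover, i.e., a subcollection C ⊆ 𝒞 of q pairwise disjoint sets covering U. -/
open Finset

namespace PCGame

section General

variable {N M : Type} [Fintype N] [Fintype M] {G : PCGame N M}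
  {x : N → M → ℝ} {p : M → ℝ}

lemma IsAssignment.le_volume (hx : G.IsAssignment x) (i : N) (j : M) : x i j ≤ G.μ i := by
  rw [← hx.2 i]
  exact Finset.single_le_sum (f := x i) (fun k _ => hx.1 i k) (Finset.mem_univ j)

lemma IsAssignment.add_le_volume [DecidableEq M] (hx : G.IsAssignment x) (i : N) {j k : M}
    (hjk : j ≠ k) : x i j + x i k ≤ G.μ i := by
  rw [← hx.2 i, ← Finset.sum_pair hjk]
  exact Finset.sum_le_sum_of_subset_of_nonneg (Finset.subset_univ _) fun k _ _ => hx.1 i k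

lemma Consistent.eq_zero (hc : G.Consistent x p) (hx : G.IsAssignment x) {i : N} {j j' : M}
    (h : G.v i j - p j < G.v i j' - p j') : x i j = 0 := by
  by_contra hne
  have := hc i j (lt_of_le_of_ne (hx.1 i j) (Ne.symm hne)) j'
  linarith

/-- The assignment that sends all of buyer type `i` to vendor `f i`. -/
noncomputable def pureAssignment [DecidableEq M] (G : PCGame N M) (f : N → M) (i : N) (j : M) : ℝ :=
  if f i = j then G.μ i else 0

lemma isAssignment_pure [DecidableEq M] (f : N → M) : G.IsAssignment (G.pureAssignment f) := by
  refine ⟨fun i j => ?_, fun i => by simp [pureAssignment]⟩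
  unfold pureAssignment
  split_ifs
  exacts [(G.μ_pos i).le, le_rfl]

lemma consistent_pure [DecidableEq M] {f : N → M}
    (h : ∀ i j, G.v i j - p j ≤ G.v i (f i) - p (f i)) : G.Consistent (G.pureAssignment f) p := by
  intro i j hij
  by_cases hf : f i = j
  · exact hf ▸ h i
  · simp [pureAssignment, hf] at hij

/-- In an equilibrium, a vendor earns at least as much as it could by deviating to a price
at which it is a best choice, possibly tied, for every buyer type in `T`. -/
lemma IsEquilibrium.revenue_le [DecidableEq M] (h : G.IsEquilibrium x p) {j : M}
    (hj : j ≠ G.abstain) {P : ℝ} (hP : G.c j ≤ P) (T : Finset N)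
    (hT : ∀ i ∈ T, ∀ j', j' ≠ j → G.v i j' - p j' ≤ G.v i j - P) :
    (P - G.c j) * ∑ i ∈ T, G.μ i ≤ G.util x p j := by
  classical
  have hbest : ∀ i, ∃ k, (∀ j', G.v i j' - Function.update p j P j' ≤
      G.v i k - Function.update p j P k) ∧ (i ∈ T → k = j) := by
    intro i
    by_cases hi : i ∈ T
    · refine ⟨j, fun j' => ?_, fun _ => rfl⟩
      by_cases hj' : j' = j
      · rw [hj']
      · simpa [hj'] using hT i hi j' hj'
    · obtain ⟨k, -, hk⟩ := Finset.exists_max_image Finset.univ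
        (fun j' => G.v i j' - Function.update p j P j') ⟨j, Finset.mem_univ _⟩
      exact ⟨k, fun j' => hk j' (Finset.mem_univ _), fun h => absurd h hi⟩
  choose f hf hfT using hbest
  refine le_trans ?_ (h.2.2.2 j hj P hP (G.pureAssignment f) (isAssignment_pure f) (consistent_pure hf))
  simp only [util, Function.update_self]
  refine mul_le_mul_of_nonneg_left ?_ (sub_nonneg.2 hP)
  calc ∑ i ∈ T, G.μ i = ∑ i ∈ T, G.pureAssignment f i j :=
        Finset.sum_congr rfl fun i hi => by simp [pureAssignment, hfT i hi]
    _ ≤ ∑ i, G.pureAssignment f i j :=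
        Finset.sum_le_sum_of_subset_of_nonneg (Finset.subset_univ _)
          fun i _ _ => (isAssignment_pure f).1 i j

end General

/-- The price competition game constructed from the set system `C`. -/
structure IsCoverGame {U : Type} [Fintype U] [DecidableEq U] (C : Finset (Finset U))
    (G : PCGame (U ⊕ U ⊕ ↥C ⊕ ↥C) (Option (↥C ⊕ U ⊕ U))) : Prop where
  card_eq : ∀ S ∈ C, S.card = 3
  abstain_eq : G.abstain = none
  volume_elem : ∀ e : U, G.μ (Sum.inl e) = 1
  volume_star : ∀ e : U, G.μ (Sum.inr (Sum.inl e)) = 1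
  volume_high : ∀ S : ↥C, G.μ (Sum.inr (Sum.inr (Sum.inl S))) = 3
  volume_low : ∀ S : ↥C, G.μ (Sum.inr (Sum.inr (Sum.inr S))) = 9
  cost_eq : ∀ j, G.c j = 0
  elem_set : ∀ (e : U) (S : ↥C), G.v (Sum.inl e) (some (Sum.inl S)) =
    if e ∈ S.1 then 12 else 0
  elem_fst : ∀ e e' : U, G.v (Sum.inl e) (some (Sum.inr (Sum.inl e'))) =
    if e = e' then 5 else 0
  elem_snd : ∀ e e' : U, G.v (Sum.inl e) (some (Sum.inr (Sum.inr e'))) =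
    if e = e' then 3 else 0
  star_set : ∀ (e : U) (S : ↥C), G.v (Sum.inr (Sum.inl e)) (some (Sum.inl S)) = 0
  star_fst : ∀ e e' : U, G.v (Sum.inr (Sum.inl e)) (some (Sum.inr (Sum.inl e'))) =
    if e = e' then 3 else 0
  star_snd : ∀ e e' : U, G.v (Sum.inr (Sum.inl e)) (some (Sum.inr (Sum.inr e'))) =
    if e = e' then 5 else 0
  high_set : ∀ S S' : ↥C, G.v (Sum.inr (Sum.inr (Sum.inl S))) (some (Sum.inl S')) =
    if S = S' then 30 else 0
  high_fst : ∀ (S : ↥C) (e : U),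
    G.v (Sum.inr (Sum.inr (Sum.inl S))) (some (Sum.inr (Sum.inl e))) = 0
  high_snd : ∀ (S : ↥C) (e : U),
    G.v (Sum.inr (Sum.inr (Sum.inl S))) (some (Sum.inr (Sum.inr e))) = 0
  low_set : ∀ S S' : ↥C, G.v (Sum.inr (Sum.inr (Sum.inr S))) (some (Sum.inl S')) =
    if S = S' then 6 else 0
  low_fst : ∀ (S : ↥C) (e : U),
    G.v (Sum.inr (Sum.inr (Sum.inr S))) (some (Sum.inr (Sum.inl e))) = 0
  low_snd : ∀ (S : ↥C) (e : U),
    G.v (Sum.inr (Sum.inr (Sum.inr S))) (some (Sum.inr (Sum.inr e))) = 0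

namespace IsCoverGame

variable {U : Type} [Fintype U] [DecidableEq U] {C : Finset (Finset U)}
  {G : PCGame (U ⊕ U ⊕ ↥C ⊕ ↥C) (Option (↥C ⊕ U ⊕ U))}
  {x : (U ⊕ U ⊕ ↥C ⊕ ↥C) → Option (↥C ⊕ U ⊕ U) → ℝ} {p : Option (↥C ⊕ U ⊕ U) → ℝ}

lemma v_none (hG : G.IsCoverGame C) (i) : G.v i none = 0 := by
  rw [← hG.abstain_eq, G.v_abstain]

lemma eq_zero_of_v_eq_zero (hG : G.IsCoverGame C) (hx : G.IsAssignment x)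
    (hc : G.Consistent x p) (h0 : p none = 0) {j} (hj : 0 < p j) {i} (hv : G.v i j = 0) :
    x i j = 0 :=
  hc.eq_zero hx (j' := none) (by rw [hv, hG.v_none, h0]; linarith)

lemma volume_of_set (hG : G.IsCoverGame C) (hx : G.IsAssignment x) (hc : G.Consistent x p)
    (h0 : p none = 0) (S : ↥C) (hS : 0 < p (some (Sum.inl S))) :
    ∑ i, x i (some (Sum.inl S)) = ∑ e ∈ S.1, x (Sum.inl e) (some (Sum.inl S)) +
      x (Sum.inr (Sum.inr (Sum.inl S))) (some (Sum.inl S)) +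
      x (Sum.inr (Sum.inr (Sum.inr S))) (some (Sum.inl S)) := by
  have key : ∀ i, G.v i (some (Sum.inl S)) = 0 → x i (some (Sum.inl S)) = 0 :=
    fun i => hG.eq_zero_of_v_eq_zero hx hc h0 hS
  rw [Fintype.sum_sum_type, Fintype.sum_sum_type, Fintype.sum_sum_type,
    Finset.sum_eq_zero (f := fun e : U => x (Sum.inr (Sum.inl e)) _)
      (fun e _ => key _ (hG.star_set e S)),
    Fintype.sum_eq_single S (fun T hT => key _ (by rw [hG.high_set, if_neg hT])),
    Fintype.sum_eq_single S (fun T hT => key _ (by rw [hG.low_set, if_neg hT])),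
    ← Finset.sum_subset (Finset.subset_univ S.1)
      (fun e _ he => key _ (by rw [hG.elem_set, if_neg he]))]
  ring

lemma volume_of_fst (hG : G.IsCoverGame C) (hx : G.IsAssignment x) (hc : G.Consistent x p)
    (h0 : p none = 0) (e : U) (he : 0 < p (some (Sum.inr (Sum.inl e)))) :
    ∑ i, x i (some (Sum.inr (Sum.inl e))) = x (Sum.inl e) (some (Sum.inr (Sum.inl e))) +
      x (Sum.inr (Sum.inl e)) (some (Sum.inr (Sum.inl e))) := by
  have key : ∀ i, G.v i (some (Sum.inr (Sum.inl e))) = 0 →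
      x i (some (Sum.inr (Sum.inl e))) = 0 :=
    fun i => hG.eq_zero_of_v_eq_zero hx hc h0 he
  rw [Fintype.sum_sum_type, Fintype.sum_sum_type, Fintype.sum_sum_type,
    Finset.sum_eq_zero (f := fun S : ↥C => x (Sum.inr (Sum.inr (Sum.inl S))) _)
      (fun S _ => key _ (hG.high_fst S e)),
    Finset.sum_eq_zero (f := fun S : ↥C => x (Sum.inr (Sum.inr (Sum.inr S))) _)
      (fun S _ => key _ (hG.low_fst S e)),
    Fintype.sum_eq_single e (fun T hT => key _ (by rw [hG.elem_fst, if_neg hT])),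
    Fintype.sum_eq_single e (fun T hT => key _ (by rw [hG.star_fst, if_neg hT]))]
  ring

lemma volume_of_snd (hG : G.IsCoverGame C) (hx : G.IsAssignment x) (hc : G.Consistent x p)
    (h0 : p none = 0) (e : U) (he : 0 < p (some (Sum.inr (Sum.inr e)))) :
    ∑ i, x i (some (Sum.inr (Sum.inr e))) = x (Sum.inl e) (some (Sum.inr (Sum.inr e))) +
      x (Sum.inr (Sum.inl e)) (some (Sum.inr (Sum.inr e))) := by
  have key : ∀ i, G.v i (some (Sum.inr (Sum.inr e))) = 0 →
      x i (some (Sum.inr (Sum.inr e))) = 0 :=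
    fun i => hG.eq_zero_of_v_eq_zero hx hc h0 he
  rw [Fintype.sum_sum_type, Fintype.sum_sum_type, Fintype.sum_sum_type,
    Finset.sum_eq_zero (f := fun S : ↥C => x (Sum.inr (Sum.inr (Sum.inl S))) _)
      (fun S _ => key _ (hG.high_snd S e)),
    Finset.sum_eq_zero (f := fun S : ↥C => x (Sum.inr (Sum.inr (Sum.inr S))) _)
      (fun S _ => key _ (hG.low_snd S e)),
    Fintype.sum_eq_single e (fun T hT => key _ (by rw [hG.elem_snd, if_neg hT])),
    Fintype.sum_eq_single e (fun T hT => key _ (by rw [hG.star_snd, if_neg hT]))]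
  ring

lemma price_nonneg (hG : G.IsCoverGame C) (h : G.IsEquilibrium x p) (j) : 0 ≤ p j :=
  hG.cost_eq j ▸ h.1.1 j

lemma price_none (hG : G.IsCoverGame C) (h : G.IsEquilibrium x p) : p none = 0 :=
  hG.abstain_eq ▸ h.1.2

lemma revenue_le (hG : G.IsCoverGame C) (h : G.IsEquilibrium x p) (j : ↥C ⊕ U ⊕ U) {P : ℝ}
    (hP : 0 ≤ P) (T : Finset (U ⊕ U ⊕ ↥C ⊕ ↥C))
    (hT : ∀ i ∈ T, ∀ j', j' ≠ some j → G.v i j' - p j' ≤ G.v i (some j) - P) :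
    P * ∑ i ∈ T, G.μ i ≤ p (some j) * ∑ i, x i (some j) := by
  have := h.revenue_le (j := some j) (by simp [hG.abstain_eq]) (by rwa [hG.cost_eq]) T hT
  simpa [util, hG.cost_eq] using this

/-- In an equilibrium, a set vendor with a low price serves all of its element buyers. -/
lemma serves_of_price_le (hG : G.IsCoverGame C) (h : G.IsEquilibrium x p) (S : ↥C)
    (hS : p (some (Sum.inl S)) ≤ 7) {e : U} (he : e ∈ S.1) :
    x (Sum.inl e) (some (Sum.inl S)) = 1 := by
  have hnn := hG.price_nonneg h
  have h0 := hG.price_none h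
  have hx := h.2.1
  have hc := h.2.2.1
  have h90 := hG.revenue_le h (Sum.inl S) (P := 30) (by norm_num)
    {Sum.inr (Sum.inr (Sum.inl S))} (by
      intro i hi j' hj'
      rw [Finset.mem_singleton.1 hi, hG.high_set, if_pos rfl]
      have := hnn j'
      rcases j' with _ | T | e | e
      · rw [hG.v_none]; linarith
      · rw [hG.high_set, if_neg (by rintro rfl; exact hj' rfl)]; linarith
      · rw [hG.high_fst]; linarith
      · rw [hG.high_snd]; linarith)
  rw [Finset.sum_singleton, hG.volume_high] at h90
  have hpos : 0 < p (some (Sum.inl S)) := by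
    rcases (hnn (some (Sum.inl S))).eq_or_lt with h' | h'
    · rw [← h'] at h90; norm_num at h90
    · exact h'
  rw [hG.volume_of_set hx hc h0 S hpos] at h90
  have hh := hx.le_volume (Sum.inr (Sum.inr (Sum.inl S))) (some (Sum.inl S))
  have hl := hx.le_volume (Sum.inr (Sum.inr (Sum.inr S))) (some (Sum.inl S))
  have hle : ∀ e : U, x (Sum.inl e) (some (Sum.inl S)) ≤ 1 := fun e =>
    hG.volume_elem e ▸ hx.le_volume _ _
  rw [hG.volume_high] at hh
  rw [hG.volume_low] at hl
  have hsum : ∑ e ∈ S.1.erase e, x (Sum.inl e) (some (Sum.inl S)) ≤ 2 := by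
    refine (Finset.sum_le_card_nsmul _ _ 1 fun e _ => hle e).trans ?_
    rw [Finset.card_erase_of_mem he, hG.card_eq _ S.2]
    norm_num
  rw [← Finset.add_sum_erase _ _ he] at h90
  have hs := hle e
  refine le_antisymm hs ?_
  rcases le_or_gt (p (some (Sum.inl S))) 6 with h6 | h6
  · nlinarith
  · have := hc.eq_zero hx (i := Sum.inr (Sum.inr (Sum.inr S))) (j := some (Sum.inl S))
      (j' := none) (by rw [hG.low_set, if_pos rfl, hG.v_none, h0]; linarith)
    rw [this] at h90
    nlinarith

/-- In an equilibrium, every element belongs to a set whose vendor has a low price. -/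
lemma exists_price_le (hG : G.IsCoverGame C) (h : G.IsEquilibrium x p) (e : U) :
    ∃ S : ↥C, e ∈ S.1 ∧ p (some (Sum.inl S)) ≤ 7 := by
  by_contra! hcon
  have hnn := hG.price_nonneg h
  have h0 := hG.price_none h
  have hx := h.2.1
  have hc := h.2.2.1
  have hvol1 := hG.volume_of_fst hx hc h0 e
  have hvol2 := hG.volume_of_snd hx hc h0 e
  obtain ⟨a, ha⟩ : ∃ a, p (some (Sum.inr (Sum.inl e))) = a := ⟨_, rfl⟩
  obtain ⟨b, hb⟩ : ∃ b, p (some (Sum.inr (Sum.inr e))) = b := ⟨_, rfl⟩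
  have hfst_elem : ∀ P, 3 - b ≤ 5 - P → 0 ≤ 5 - P →
      (∀ S : ↥C, e ∈ S.1 → 12 - p (some (Sum.inl S)) ≤ 5 - P) → ∀ j',
      j' ≠ some (Sum.inr (Sum.inl e)) → G.v (Sum.inl e) j' - p j' ≤
        G.v (Sum.inl e) (some (Sum.inr (Sum.inl e))) - P := by
    intro P h1 h2 h3 j' hj'
    rw [hG.elem_fst, if_pos rfl]
    have := hnn j'
    rcases j' with _ | S | e' | e'
    · rw [hG.v_none]; linarith
    · rw [hG.elem_set]
      split_ifs with hS
      · exact h3 S hS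
      · linarith
    · rw [hG.elem_fst, if_neg (by rintro rfl; exact hj' rfl)]; linarith
    · rw [hG.elem_snd]
      split_ifs with hS
      · subst hS; linarith
      · linarith
  have hfst_star : ∀ P, 5 - b ≤ 3 - P → 0 ≤ 3 - P → ∀ j',
      j' ≠ some (Sum.inr (Sum.inl e)) → G.v (Sum.inr (Sum.inl e)) j' - p j' ≤
        G.v (Sum.inr (Sum.inl e)) (some (Sum.inr (Sum.inl e))) - P := by
    intro P h1 h2 j' hj'
    rw [hG.star_fst, if_pos rfl]
    have := hnn j'
    rcases j' with _ | S | e' | e'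
    · rw [hG.v_none]; linarith
    · rw [hG.star_set]; linarith
    · rw [hG.star_fst, if_neg (by rintro rfl; exact hj' rfl)]; linarith
    · rw [hG.star_snd]
      split_ifs with hS
      · subst hS; linarith
      · linarith
  have hsnd_star : ∀ P, 3 - a ≤ 5 - P → 0 ≤ 5 - P → ∀ j',
      j' ≠ some (Sum.inr (Sum.inr e)) → G.v (Sum.inr (Sum.inl e)) j' - p j' ≤
        G.v (Sum.inr (Sum.inl e)) (some (Sum.inr (Sum.inr e))) - P := by
    intro P h1 h2 j' hj'
    rw [hG.star_snd, if_pos rfl]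
    have := hnn j'
    rcases j' with _ | S | e' | e'
    · rw [hG.v_none]; linarith
    · rw [hG.star_set]; linarith
    · rw [hG.star_fst]
      split_ifs with hS
      · subst hS; linarith
      · linarith
    · rw [hG.star_snd, if_neg (by rintro rfl; exact hj' rfl)]; linarith
  have hdev1 := fun P => hG.revenue_le h (Sum.inr (Sum.inl e)) (P := P)
  have hdev2 := fun P => hG.revenue_le h (Sum.inr (Sum.inr e)) (P := P)
  have hA := hx.add_le_volume (Sum.inl e) (j := some (Sum.inr (Sum.inl e)))
    (k := some (Sum.inr (Sum.inr e))) (by simp)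
  have hB := hx.add_le_volume (Sum.inr (Sum.inl e)) (j := some (Sum.inr (Sum.inl e)))
    (k := some (Sum.inr (Sum.inr e))) (by simp)
  rw [hG.volume_elem] at hA
  rw [hG.volume_star] at hB
  have hcA1 := hc (Sum.inl e) (some (Sum.inr (Sum.inl e)))
  have hcA2 := hc (Sum.inl e) (some (Sum.inr (Sum.inr e)))
  have hcB1 := hc (Sum.inr (Sum.inl e)) (some (Sum.inr (Sum.inl e)))
  have hcB2 := hc (Sum.inr (Sum.inl e)) (some (Sum.inr (Sum.inr e)))
  have hnA1 := hx.1 (Sum.inl e) (some (Sum.inr (Sum.inl e)))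
  have hnA2 := hx.1 (Sum.inl e) (some (Sum.inr (Sum.inr e)))
  have hnB1 := hx.1 (Sum.inr (Sum.inl e)) (some (Sum.inr (Sum.inl e)))
  have hnB2 := hx.1 (Sum.inr (Sum.inl e)) (some (Sum.inr (Sum.inr e)))
  have hna := ha ▸ hnn (some (Sum.inr (Sum.inl e)))
  have hnb := hb ▸ hnn (some (Sum.inr (Sum.inr e)))
  have hS : ∀ S : ↥C, e ∈ S.1 → G.v (Sum.inl e) (some (Sum.inl S)) = 12 := fun S hS => by
    rw [hG.elem_set, if_pos hS]
  simp only [ha, hb] at hdev1 hdev2 hvol1 hvol2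
  simp only [hG.elem_fst, hG.elem_snd, hG.star_fst, hG.star_snd, if_true, ha, hb]
    at hcA1 hcA2 hcB1 hcB2 hfst_elem hfst_star hsnd_star
  generalize x (Sum.inl e) (some (Sum.inr (Sum.inl e))) = A1 at *
  generalize x (Sum.inl e) (some (Sum.inr (Sum.inr e))) = A2 at *
  generalize x (Sum.inr (Sum.inl e)) (some (Sum.inr (Sum.inl e))) = B1 at *
  generalize x (Sum.inr (Sum.inl e)) (some (Sum.inr (Sum.inr e))) = B2 at *
  generalize ∑ i, x i (some (Sum.inr (Sum.inl e))) = V1 at *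
  generalize ∑ i, x i (some (Sum.inr (Sum.inr e))) = V2 at *
  have hdev_elem : ∀ P, 0 ≤ P → 3 - b ≤ 5 - P → 0 ≤ 5 - P →
      (∀ S : ↥C, e ∈ S.1 → 12 - p (some (Sum.inl S)) ≤ 5 - P) → P ≤ a * V1 := by
    intro P hP h1 h2 h3
    have := hdev1 P hP {Sum.inl e} fun i hi => by
      rw [Finset.mem_singleton.1 hi, hG.elem_fst, if_pos rfl]
      exact hfst_elem P h1 h2 h3
    rwa [Finset.sum_singleton, hG.volume_elem, mul_one] at this
  have hdev_both : ∀ P, 0 ≤ P → 5 - b ≤ 3 - P → 0 ≤ 3 - P →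
      (∀ S : ↥C, e ∈ S.1 → 12 - p (some (Sum.inl S)) ≤ 5 - P) → P * 2 ≤ a * V1 := by
    intro P hP h1 h2 h3
    have := hdev1 P hP {Sum.inl e, Sum.inr (Sum.inl e)} fun i hi => by
      rcases Finset.mem_insert.1 hi with rfl | hi
      · rw [hG.elem_fst, if_pos rfl]
        exact hfst_elem P (by linarith) (by linarith) h3
      · rw [Finset.mem_singleton.1 hi, hG.star_fst, if_pos rfl]
        exact hfst_star P h1 h2
    rw [Finset.sum_pair (by simp), hG.volume_elem, hG.volume_star] at this
    linarith
  have hdev_star : ∀ P, 0 ≤ P → 3 - a ≤ 5 - P → 0 ≤ 5 - P → P ≤ b * V2 := by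
    intro P hP h1 h2
    have := hdev2 P hP {Sum.inr (Sum.inl e)} fun i hi => by
      rw [Finset.mem_singleton.1 hi, hG.star_snd, if_pos rfl]
      exact hsnd_star P h1 h2
    rwa [Finset.sum_singleton, hG.volume_star, mul_one] at this
  obtain ⟨ε, hε, hε2, hεS⟩ : ∃ ε : ℝ, 0 < ε ∧ ε ≤ 2 ∧
      ∀ S : ↥C, e ∈ S.1 → 12 - p (some (Sum.inl S)) ≤ 5 - ε := by
    obtain ⟨o, ho⟩ := Finite.exists_min fun o : Option ↥C =>
      o.elim (2 : ℝ) fun S => if e ∈ S.1 then p (some (Sum.inl S)) - 7 else 2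
    refine ⟨_, ?_, ho none, fun S hS => ?_⟩
    · rcases o with _ | S
      · norm_num
      · simp only [Option.elim_some]
        split_ifs with hS
        · linarith [hcon S hS]
        · norm_num
    · have := ho (some S)
      simp only [Option.elim_some, if_pos hS] at this
      linarith
  have ha0 : 0 < a := by
    refine hna.lt_of_ne fun h => ?_
    have := hdev_elem ε hε.le (by linarith) (by linarith) hεS
    rw [← h] at this
    linarith
  have hb0 : 0 < b := by
    refine hnb.lt_of_ne fun h => ?_
    have := hdev_star 2 (by norm_num) (by linarith) (by norm_num)
    rw [← h] at this
    linarith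
  have hV1 := hvol1 ha0
  have hV2 := hvol2 hb0
  have hV1pos : 0 < V1 := by
    have := hdev_elem ε hε.le (by linarith) (by linarith) hεS
    exact pos_of_mul_pos_right (hε.trans_le this) hna
  have hV2pos : 0 < V2 := by
    have := hdev_star 2 (by norm_num) (by linarith) (by norm_num)
    exact pos_of_mul_pos_right (by linarith) hnb
  have hge1 : ∀ k, a * k ≤ a * V1 → k ≤ V1 := fun k hk => le_of_mul_le_mul_left hk ha0
  have hge2 : ∀ k, b * k ≤ b * V2 → k ≤ V2 := fun k hk => le_of_mul_le_mul_left hk hb0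
  have hB2e : 0 < B2 → 0 ≤ 5 - b ∧ 3 - a ≤ 5 - b := fun hB2 => by
    have h1 := hcB2 hB2 none
    have h2 := hcB2 hB2 (some (Sum.inr (Sum.inl e)))
    rw [hG.v_none, h0] at h1
    rw [hG.star_fst, if_pos rfl, ha] at h2
    exact ⟨by linarith, h2⟩
  have hB1e : 0 < B1 → 0 ≤ 3 - a ∧ 5 - b ≤ 3 - a := fun hB1 => by
    have h1 := hcB1 hB1 none
    have h2 := hcB1 hB1 (some (Sum.inr (Sum.inr e)))
    rw [hG.v_none, h0] at h1
    rw [hG.star_snd, if_pos rfl, hb] at h2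
    exact ⟨by linarith, h2⟩
  rcases hnA1.eq_or_lt with hA1 | hA1
  · have hB1 := hB1e (by linarith)
    have hA2 : A2 = 0 := by
      by_contra hne
      have := hcA2 (hnA2.lt_of_ne (Ne.symm hne)) (some (Sum.inr (Sum.inl e)))
      rw [hG.elem_fst, if_pos rfl, ha] at this
      linarith
    have hB2 := hB2e (by linarith)
    have := hge2 1 (by linarith [hdev_star b hnb hB2.2 hB2.1])
    linarith
  · have hA1e := hcA1 hA1
    have hA1S : ∀ S : ↥C, e ∈ S.1 → 12 - p (some (Sum.inl S)) ≤ 5 - a := fun S he => by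
      rw [← hS S he]; exact hA1e _
    have hA1n := hA1e none
    have hA1b := hA1e (some (Sum.inr (Sum.inr e)))
    rw [hG.v_none, h0] at hA1n
    rw [hG.elem_snd, if_pos rfl, hb] at hA1b
    rcases hnB1.eq_or_lt with hB1 | hB1
    · have h1 := hge1 1 (by linarith [hdev_elem a hna hA1b (by linarith) hA1S])
      have hB2 := hB2e (by linarith)
      have hbV : b * V2 ≤ b := mul_le_of_le_one_right hnb (by linarith)
      have haV : a * V1 ≤ a := mul_le_of_le_one_right hna (by linarith)
      rcases le_or_gt a 3 with h3 | h3
      · have h2 := hdev_star (a + 2) (by linarith) (by linarith) (by linarith)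
        linarith [hdev_both a hna (by linarith) (by linarith) hA1S]
      · have h2 := hdev_star 5 (by norm_num) (by linarith) (by norm_num)
        linarith [hdev_both 3 (by norm_num) (by linarith) (by norm_num)
          fun S hS => by linarith [hA1S S hS]]
    · have hB1' := hB1e hB1
      have := hge1 2 (by linarith [hdev_both a hna hB1'.2 hB1'.1 hA1S])
      linarith

lemma exists_cover (hG : G.IsCoverGame C) {q : ℕ} (hU : Fintype.card U = 3 * q)
    (h : G.IsEquilibrium x p) : ∃ Cov : Finset (Finset U), Cov ⊆ C ∧ Cov.card = q ∧
      (↑Cov : Set (Finset U)).Pairwise (fun S T => Disjoint S T) ∧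
      ∀ e : U, ∃ S ∈ Cov, e ∈ S := by
  classical
  let Cov := C.filter fun S => ∃ hS : S ∈ C, p (some (Sum.inl ⟨S, hS⟩)) ≤ 7
  have hdisj : (↑Cov : Set (Finset U)).Pairwise (fun S T => Disjoint S T) := by
    intro S hS T hT hST
    obtain ⟨-, hS, hpS⟩ := Finset.mem_filter.1 (Finset.mem_coe.1 hS)
    obtain ⟨-, hT, hpT⟩ := Finset.mem_filter.1 (Finset.mem_coe.1 hT)
    refine Finset.disjoint_left.2 fun e heS heT => ?_
    have hle := h.2.1.add_le_volume (Sum.inl e) (j := some (Sum.inl ⟨S, hS⟩))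
      (k := some (Sum.inl ⟨T, hT⟩)) (by simpa using hST)
    rw [hG.serves_of_price_le h ⟨S, hS⟩ hpS heS, hG.serves_of_price_le h ⟨T, hT⟩ hpT heT,
      hG.volume_elem] at hle
    norm_num at hle
  have hcov : ∀ e : U, ∃ S ∈ Cov, e ∈ S := fun e => by
    obtain ⟨S, he, hS⟩ := hG.exists_price_le h e
    exact ⟨S.1, Finset.mem_filter.2 ⟨S.2, S.2, hS⟩, he⟩
  refine ⟨Cov, Finset.filter_subset _ _, ?_, hdisj, hcov⟩
  have hunion : Cov.biUnion id = Finset.univ := Finset.eq_univ_iff_forall.2 fun e => by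
    simpa using hcov e
  have hcard := Finset.card_biUnion (s := Cov) (t := id) hdisj
  have hthree : ∀ S ∈ Cov, (id S).card = 3 := fun S hS =>
    hG.card_eq S (Finset.mem_filter.1 hS).1
  rw [hunion, Finset.card_univ, hU, Finset.sum_const_nat hthree] at hcard
  omega

/-- Equilibrium prices derived from a cover. -/
def coverPrice (Cov : Finset (Finset U)) : Option (↥C ⊕ U ⊕ U) → ℝ
  | none => 0
  | some (Sum.inl S) => if S.1 ∈ Cov then 6 else 30
  | some (Sum.inr (Sum.inl _)) => 0
  | some (Sum.inr (Sum.inr _)) => 2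

/-- Equilibrium choices derived from a cover, `s e` being the chosen set containing `e`. -/
def coverChoice (Cov : Finset (Finset U)) (s : U → ↥C) :
    U ⊕ U ⊕ ↥C ⊕ ↥C → Option (↥C ⊕ U ⊕ U)
  | Sum.inl e => some (Sum.inl (s e))
  | Sum.inr (Sum.inl e) => some (Sum.inr (Sum.inr e))
  | Sum.inr (Sum.inr (Sum.inl S)) => some (Sum.inl S)
  | Sum.inr (Sum.inr (Sum.inr S)) => if S.1 ∈ Cov then some (Sum.inl S) else none

lemma isPrice_coverPrice (hG : G.IsCoverGame C) (Cov : Finset (Finset U)) :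
    G.IsPrice (coverPrice Cov) := by
  refine ⟨fun j => ?_, by rw [hG.abstain_eq]; rfl⟩
  rw [hG.cost_eq]
  rcases j with _ | S | e | e <;> simp only [coverPrice] <;> (try split_ifs) <;> norm_num

lemma consistent_cover (hG : G.IsCoverGame C) {Cov : Finset (Finset U)} {s : U → ↥C}
    (hs : ∀ e, (s e).1 ∈ Cov) (hmem : ∀ e, e ∈ (s e).1) :
    G.Consistent (G.pureAssignment (coverChoice Cov s)) (coverPrice Cov) := by
  refine consistent_pure fun i j => ?_
  rcases i with e | e | S | S
  · rcases j with _ | T | e' | e' <;>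
      simp only [coverChoice, coverPrice, hG.v_none, hG.elem_set, hG.elem_fst, hG.elem_snd,
        hs, hmem, if_true] <;> (try split_ifs) <;> norm_num
  · rcases j with _ | T | e' | e' <;>
      simp only [coverChoice, coverPrice, hG.v_none, hG.star_set, hG.star_fst, hG.star_snd,
        if_true] <;> (try split_ifs) <;> norm_num
  · rcases j with _ | T | e' | e' <;>
      simp only [coverChoice, coverPrice, hG.v_none, hG.high_set, hG.high_fst, hG.high_snd,
        if_true] <;> (try split_ifs) <;> simp_all <;> norm_num
  · by_cases hS : S.1 ∈ Cov
    · rcases j with _ | T | e' | e' <;>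
        simp only [coverChoice, coverPrice, hG.v_none, hG.low_set, hG.low_fst, hG.low_snd,
          hS, if_true] <;> (try split_ifs) <;> norm_num
    · rcases j with _ | T | e' | e' <;>
        simp only [coverChoice, coverPrice, hG.v_none, hG.low_set, hG.low_fst, hG.low_snd,
          hS, if_false] <;> (try split_ifs) <;> simp_all
      norm_num

lemma util_cover_set (hG : G.IsCoverGame C) {Cov : Finset (Finset U)} {s : U → ↥C}
    (hs : ∀ e, (s e).1 ∈ Cov) (hmem : ∀ e, e ∈ (s e).1)
    (hdisj : (↑Cov : Set (Finset U)).Pairwise (fun S T => Disjoint S T)) (S : ↥C) :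
    90 ≤ G.util (G.pureAssignment (coverChoice Cov s)) (coverPrice Cov) (some (Sum.inl S)) := by
  have hsum := hG.volume_of_set (isAssignment_pure _) (hG.consistent_cover hs hmem) rfl S
    (by simp only [coverPrice]; split_ifs <;> norm_num)
  have hhigh : G.pureAssignment (coverChoice Cov s) (Sum.inr (Sum.inr (Sum.inl S)))
      (some (Sum.inl S)) = 3 := by simp [pureAssignment, coverChoice, hG.volume_high]
  rw [util, hsum, hhigh, hG.cost_eq]
  by_cases hS : S.1 ∈ Cov
  · have hlow : G.pureAssignment (coverChoice Cov s) (Sum.inr (Sum.inr (Sum.inr S)))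
        (some (Sum.inl S)) = 9 := by simp [pureAssignment, coverChoice, hG.volume_low, hS]
    have helem : ∀ e ∈ S.1, G.pureAssignment (coverChoice Cov s) (Sum.inl e) (some (Sum.inl S)) = 1 := by
      intro e he
      have : s e = S := by
        by_contra hne
        exact Finset.disjoint_left.1 (hdisj (hs e) hS fun h => hne (Subtype.ext h)) (hmem e) he
      simp [pureAssignment, coverChoice, hG.volume_elem, this]
    rw [Finset.sum_congr rfl helem, hlow, Finset.sum_const, hG.card_eq _ S.2]
    simp only [coverPrice, if_pos hS]
    norm_num
  · have h1 := (isAssignment_pure (G := G) (coverChoice Cov s)).1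
    have h2 : 0 ≤ ∑ e ∈ S.1, G.pureAssignment (coverChoice Cov s) (Sum.inl e) (some (Sum.inl S)) :=
      Finset.sum_nonneg fun e _ => h1 _ _
    have h3 := h1 (Sum.inr (Sum.inr (Sum.inr S))) (some (Sum.inl S))
    simp only [coverPrice, if_neg hS]
    linarith

lemma util_cover_snd (hG : G.IsCoverGame C) {Cov : Finset (Finset U)} {s : U → ↥C} (e : U) :
    2 ≤ G.util (G.pureAssignment (coverChoice Cov s)) (coverPrice Cov) (some (Sum.inr (Sum.inr e))) := by
  have h1 := Finset.single_le_sum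
    (f := fun i => G.pureAssignment (coverChoice Cov s) i (some (Sum.inr (Sum.inr e))))
    (fun i _ => (isAssignment_pure (G := G) (coverChoice Cov s)).1 i _)
    (Finset.mem_univ (Sum.inr (Sum.inl e)))
  have h2 : G.pureAssignment (coverChoice Cov s) (Sum.inr (Sum.inl e)) (some (Sum.inr (Sum.inr e))) = 1 := by
    simp [pureAssignment, coverChoice, hG.volume_star]
  rw [h2] at h1
  rw [util, hG.cost_eq]
  simp only [coverPrice]
  linarith

/-- No deviation earns a set vendor more than `90`, provided that its element buyers could
buy from their own element vendors for free. -/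
lemma util_set_le (hG : G.IsCoverGame C) (hx : G.IsAssignment x) (hc : G.Consistent x p)
    (h0 : p none = 0) (S : ↥C) (hS : 0 ≤ p (some (Sum.inl S)))
    (hfst : ∀ e, p (some (Sum.inr (Sum.inl e))) = 0) :
    G.util x p (some (Sum.inl S)) ≤ 90 := by
  rw [util, hG.cost_eq, sub_zero]
  rcases hS.eq_or_lt with hS | hpos
  · rw [← hS]; norm_num
  rw [hG.volume_of_set hx hc h0 S hpos]
  have hh := hx.le_volume (Sum.inr (Sum.inr (Sum.inl S))) (some (Sum.inl S))
  have hl := hx.le_volume (Sum.inr (Sum.inr (Sum.inr S))) (some (Sum.inl S))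
  rw [hG.volume_high] at hh
  rw [hG.volume_low] at hl
  have hsum : ∑ e ∈ S.1, x (Sum.inl e) (some (Sum.inl S)) ≤ 3 := by
    refine (Finset.sum_le_card_nsmul _ _ 1 fun e _ =>
      hG.volume_elem e ▸ hx.le_volume _ _).trans ?_
    rw [hG.card_eq _ S.2]
    norm_num
  rcases le_or_gt (p (some (Sum.inl S))) 6 with h6 | h6
  · nlinarith
  rw [hc.eq_zero hx (i := Sum.inr (Sum.inr (Sum.inr S))) (j' := none)
    (by rw [hG.low_set, if_pos rfl, hG.v_none, h0]; linarith)]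
  rcases le_or_gt (p (some (Sum.inl S))) 7 with h7 | h7
  · nlinarith
  rw [Finset.sum_eq_zero fun e he => hc.eq_zero hx (j' := some (Sum.inr (Sum.inl e)))
    (by rw [hG.elem_set, if_pos he, hG.elem_fst, if_pos rfl, hfst]; linarith)]
  rcases le_or_gt (p (some (Sum.inl S))) 30 with h30 | h30
  · nlinarith
  rw [hc.eq_zero hx (i := Sum.inr (Sum.inr (Sum.inl S))) (j' := none)
    (by rw [hG.high_set, if_pos rfl, hG.v_none, h0]; linarith)]
  norm_num

lemma util_fst_le (hG : G.IsCoverGame C) (hx : G.IsAssignment x) (hc : G.Consistent x p)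
    (h0 : p none = 0) (e : U) (he : 0 ≤ p (some (Sum.inr (Sum.inl e)))) {S : ↥C}
    (heS : e ∈ S.1) (hS : p (some (Sum.inl S)) = 6)
    (hsnd : p (some (Sum.inr (Sum.inr e))) = 2) :
    G.util x p (some (Sum.inr (Sum.inl e))) ≤ 0 := by
  rw [util, hG.cost_eq, sub_zero]
  rcases he.eq_or_lt with he | hpos
  · rw [← he]; norm_num
  rw [hG.volume_of_fst hx hc h0 e hpos,
    hc.eq_zero hx (i := Sum.inl e) (j' := some (Sum.inl S))
      (by rw [hG.elem_set, if_pos heS, hG.elem_fst, if_pos rfl, hS]; linarith),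
    hc.eq_zero hx (i := Sum.inr (Sum.inl e)) (j' := some (Sum.inr (Sum.inr e)))
      (by rw [hG.star_snd, if_pos rfl, hG.star_fst, if_pos rfl, hsnd]; linarith)]
  norm_num

lemma util_snd_le (hG : G.IsCoverGame C) (hx : G.IsAssignment x) (hc : G.Consistent x p)
    (h0 : p none = 0) (e : U) (he : 0 ≤ p (some (Sum.inr (Sum.inr e)))) {S : ↥C}
    (heS : e ∈ S.1) (hS : p (some (Sum.inl S)) = 6)
    (hfst : p (some (Sum.inr (Sum.inl e))) = 0) :
    G.util x p (some (Sum.inr (Sum.inr e))) ≤ 2 := by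
  rw [util, hG.cost_eq, sub_zero]
  rcases he.eq_or_lt with he | hpos
  · rw [← he]; norm_num
  rw [hG.volume_of_snd hx hc h0 e hpos,
    hc.eq_zero hx (i := Sum.inl e) (j' := some (Sum.inl S))
      (by rw [hG.elem_set, if_pos heS, hG.elem_snd, if_pos rfl, hS]; linarith)]
  rcases le_or_gt (p (some (Sum.inr (Sum.inr e)))) 2 with h2 | h2
  · have := hx.le_volume (Sum.inr (Sum.inl e)) (some (Sum.inr (Sum.inr e)))
    rw [hG.volume_star] at this
    nlinarith
  rw [hc.eq_zero hx (i := Sum.inr (Sum.inl e)) (j' := some (Sum.inr (Sum.inl e)))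
    (by rw [hG.star_snd, if_pos rfl, hG.star_fst, if_pos rfl, hfst]; linarith)]
  norm_num

lemma isEquilibrium_cover (hG : G.IsCoverGame C) {Cov : Finset (Finset U)} {s : U → ↥C}
    (hs : ∀ e, (s e).1 ∈ Cov) (hmem : ∀ e, e ∈ (s e).1)
    (hdisj : (↑Cov : Set (Finset U)).Pairwise (fun S T => Disjoint S T)) :
    G.IsEquilibrium (G.pureAssignment (coverChoice Cov s)) (coverPrice Cov) := by
  refine ⟨hG.isPrice_coverPrice Cov, isAssignment_pure _, hG.consistent_cover hs hmem, ?_⟩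
  intro j hj P hP y hy hyc
  rw [hG.cost_eq] at hP
  rcases j with _ | S | e | e
  · exact absurd hG.abstain_eq.symm hj
  · exact (hG.util_set_le hy hyc (by simp [coverPrice]) S (by simpa using hP)
      (by simp [coverPrice])).trans (hG.util_cover_set hs hmem hdisj S)
  · refine (hG.util_fst_le hy hyc (by simp [coverPrice]) e (by simpa using hP) (hmem e)
      (by simp [coverPrice, hs]) (by simp [coverPrice])).trans ?_
    simp [util, coverPrice, hG.cost_eq]
  · exact (hG.util_snd_le hy hyc (by simp [coverPrice]) e (by simpa using hP) (hmem e)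
      (by simp [coverPrice, hs]) (by simp [coverPrice])).trans (hG.util_cover_snd e)

end IsCoverGame

end PCGame

/-- the price competition game constructed from an Exact-3-Cover
instance admits an equilibrium iff the instance admits an exact cover.
Buyer types: `Sum.inl e` is `b_e`, `Sum.inr (Sum.inl e)` is `b*_e`,
`Sum.inr (Sum.inr (Sum.inl S))` is `b_{S,h}`, `Sum.inr (Sum.inr (Sum.inr S))` is
`b_{S,ℓ}`.  Vendors: `none` is the abstain option, `some (Sum.inl S)` is `ν_S`,
`some (Sum.inr (Sum.inl e))` is `ν_{e,1}`, `some (Sum.inr (Sum.inr e))` is `ν_{e,2}`. -/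
theorem stmt10 {U : Type} [Fintype U] [DecidableEq U] (q : ℕ)
    (hU : Fintype.card U = 3 * q)
    (C : Finset (Finset U)) (hC : ∀ S ∈ C, S.card = 3)
    (G : PCGame (U ⊕ U ⊕ ↥C ⊕ ↥C) (Option (↥C ⊕ U ⊕ U)))
    (hab : G.abstain = none)
    (hμe : ∀ e : U, G.μ (Sum.inl e) = 1)
    (hμs : ∀ e : U, G.μ (Sum.inr (Sum.inl e)) = 1)
    (hμh : ∀ S : ↥C, G.μ (Sum.inr (Sum.inr (Sum.inl S))) = 3)
    (hμl : ∀ S : ↥C, G.μ (Sum.inr (Sum.inr (Sum.inr S))) = 9)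
    (hcost : ∀ j, G.c j = 0)
    (hv1 : ∀ (e : U) (S : ↥C), G.v (Sum.inl e) (some (Sum.inl S)) =
      if e ∈ S.1 then 12 else 0)
    (hv2 : ∀ e e' : U, G.v (Sum.inl e) (some (Sum.inr (Sum.inl e'))) =
      if e = e' then 5 else 0)
    (hv3 : ∀ e e' : U, G.v (Sum.inl e) (some (Sum.inr (Sum.inr e'))) =
      if e = e' then 3 else 0)
    (hv4 : ∀ (e : U) (S : ↥C), G.v (Sum.inr (Sum.inl e)) (some (Sum.inl S)) = 0)
    (hv5 : ∀ e e' : U, G.v (Sum.inr (Sum.inl e)) (some (Sum.inr (Sum.inl e'))) =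
      if e = e' then 3 else 0)
    (hv6 : ∀ e e' : U, G.v (Sum.inr (Sum.inl e)) (some (Sum.inr (Sum.inr e'))) =
      if e = e' then 5 else 0)
    (hv7 : ∀ S S' : ↥C, G.v (Sum.inr (Sum.inr (Sum.inl S))) (some (Sum.inl S')) =
      if S = S' then 30 else 0)
    (hv8 : ∀ (S : ↥C) (e : U),
      G.v (Sum.inr (Sum.inr (Sum.inl S))) (some (Sum.inr (Sum.inl e))) = 0)
    (hv9 : ∀ (S : ↥C) (e : U),
      G.v (Sum.inr (Sum.inr (Sum.inl S))) (some (Sum.inr (Sum.inr e))) = 0)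
    (hv10 : ∀ S S' : ↥C, G.v (Sum.inr (Sum.inr (Sum.inr S))) (some (Sum.inl S')) =
      if S = S' then 6 else 0)
    (hv11 : ∀ (S : ↥C) (e : U),
      G.v (Sum.inr (Sum.inr (Sum.inr S))) (some (Sum.inr (Sum.inl e))) = 0)
    (hv12 : ∀ (S : ↥C) (e : U),
      G.v (Sum.inr (Sum.inr (Sum.inr S))) (some (Sum.inr (Sum.inr e))) = 0) :
    (∃ (x : (U ⊕ U ⊕ ↥C ⊕ ↥C) → Option (↥C ⊕ U ⊕ U) → ℝ)
        (p : Option (↥C ⊕ U ⊕ U) → ℝ), G.IsEquilibrium x p) ↔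
      ∃ Cov : Finset (Finset U), Cov ⊆ C ∧ Cov.card = q ∧
        (↑Cov : Set (Finset U)).Pairwise (fun S T => Disjoint S T) ∧
        ∀ e : U, ∃ S ∈ Cov, e ∈ S := by
  have hG : G.IsCoverGame C := ⟨hC, hab, hμe, hμs, hμh, hμl, hcost, hv1, hv2, hv3, hv4, hv5, hv6,
    hv7, hv8, hv9, hv10, hv11, hv12⟩
  constructor
  · rintro ⟨x, p, h⟩
    exact hG.exists_cover hU h
  · rintro ⟨Cov, hsub, -, hdisj, hcov⟩
    choose s hs hmem using hcov
    exact ⟨_, _, hG.isEquilibrium_cover (s := fun e => ⟨s e, hsub (hs e)⟩) hs hmem hdisj⟩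
end
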